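/- Let Λ = (W_j, Λ_j, v_j) be a g-fusion frame for H with frame operator S_Λ, and let the canonical dual be ~Λ = (~W_j, ~Λ_j, v_j) where ~W_j = S_Λ^{-1} W_j and ~Λ_j = Λ_j π_{W_j} S_Λ^{-1}. Then the frame operator of the dual satisfies S_{~Λ} = S_Λ^{-1}, and every f ∈ H satisfies f = Σ_{j∈J} v_j² π_{W_j} Λ_j* ~Λ_j π_{~W_j} f = Σ_{j∈J} v_j² π_{~W_j} ~Λ_j* Λ_j π_{W_j} f. -/

import Mathlib

noncomputable section

open ContinuousLinearMap Submodule Set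

variable {H : Type*} [NormedAddCommGroup H] [InnerProductSpace ℂ H] [CompleteSpace H]

/-- The orthogonal projection onto a (complete, i.e. closed) subspace `K` of `H`,
viewed as a continuous endomorphism of `H`. -/
def gfP (K : Submodule ℂ H) [CompleteSpace K] : H →L[ℂ] H :=
  K.subtypeL.comp (orthogonalProjection K)

/-- The orthogonal projection onto the topological closure of a subspace `K` of `H`
(for a subspace which is already closed, e.g. the image of a closed subspace under a
topological isomorphism, this is the projection onto `K` itself). -/
def gfPc (K : Submodule ℂ H) : H →L[ℂ] H :=
  haveI : CompleteSpace K.topologicalClosure :=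
    K.isClosed_topologicalClosure.completeSpace_coe
  (K.topologicalClosure).subtypeL.comp (orthogonalProjection K.topologicalClosure)

theorem gfP_inner_left (K : Submodule ℂ H) [CompleteSpace K] (x y : H) :
    inner ℂ (gfP K x) y = inner ℂ x (gfP K y) :=
  Submodule.inner_starProjection_left_eq_right K x y

theorem gfPc_inner_left (K : Submodule ℂ H) (x y : H) :
    inner ℂ (gfPc K x) y = inner ℂ x (gfPc K y) :=
  haveI : CompleteSpace K.topologicalClosure :=
    K.isClosed_topologicalClosure.completeSpace_coe
  Submodule.inner_starProjection_left_eq_right K.topologicalClosure x y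

theorem gfP_apply_mem (K : Submodule ℂ H) [CompleteSpace K] (x : H) : gfP K x ∈ K :=
  Submodule.starProjection_apply_mem K x

theorem gfPc_apply_of_mem {K : Submodule ℂ H} {x : H} (hx : x ∈ K) : gfPc K x = x :=
  haveI : CompleteSpace K.topologicalClosure :=
    K.isClosed_topologicalClosure.completeSpace_coe
  Submodule.starProjection_eq_self_iff.2 (K.le_topologicalClosure hx)

/-- For a symmetric operator `T`, the projection onto `K` composed with `T` only sees the
component of a vector in the closure of `T K`. -/
theorem gfP_comp_gfPc_map {T : H →L[ℂ] H} (hT : ∀ x y, inner ℂ (T x) y = inner ℂ x (T y))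
    (K : Submodule ℂ H) [CompleteSpace K] (x : H) :
    gfP K (T (gfPc (K.map (T : H →ₗ[ℂ] H)) x)) = gfP K (T x) := by
  refine ext_inner_right ℂ fun y => ?_
  have h : gfPc (K.map (T : H →ₗ[ℂ] H)) (T (gfP K y)) = T (gfP K y) :=
    gfPc_apply_of_mem (Submodule.mem_map_of_mem (gfP_apply_mem K y))
  rw [gfP_inner_left, hT, gfPc_inner_left, h, gfP_inner_left, hT]

/-- An operator given pointwise by a convergent series of symmetric operators is symmetric. -/
theorem inner_left_of_hasSum {ι : Type*} {F : ι → H → H} {S : H → H}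
    (hF : ∀ j x y, inner ℂ (F j x) y = inner ℂ x (F j y))
    (hS : ∀ x, HasSum (fun j => F j x) (S x)) (x y : H) :
    inner ℂ (S x) y = inner ℂ x (S y) := by
  have h₁ : HasSum (fun j => inner ℂ (F j x) y) (inner ℂ (S x) y) :=
    (hS x).mapL ((innerSL ℂ).flip y)
  have h₂ : HasSum (fun j => inner ℂ x (F j y)) (inner ℂ x (S y)) :=
    (hS y).mapL (innerSL ℂ x)
  simp only [hF] at h₁
  exact h₁.unique h₂

/-- Let `(W j, Λ j, v j)` be a g-fusion frame for `H` with frame operator `S`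
(with inverse `Sinv`), and let the canonical dual be `(W̃ j, Λ̃ j, v j)` with
`W̃ j = S⁻¹ W j` and `Λ̃ j = Λ j ∘ π_{W j} ∘ S⁻¹`. Then the frame operator of the dual equals
`S⁻¹`, and every `f` satisfies
`f = ∑ j, v j ^ 2 • π_{W j} (Λ j)* (Λ̃ j (π_{W̃ j} f)) = ∑ j, v j ^ 2 • π_{W̃ j} (Λ̃ j)* (Λ j (π_{W j} f))`. -/
theorem stmt10 {ι : Type*} [Countable ι] {G : ι → Type*}
    [∀ j, NormedAddCommGroup (G j)] [∀ j, InnerProductSpace ℂ (G j)] [∀ j, CompleteSpace (G j)]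
    (W : ι → Submodule ℂ H) [∀ j, CompleteSpace (W j)]
    (Λ : ∀ j, H →L[ℂ] G j) (v : ι → ℝ) (hv : ∀ j, 0 < v j)
    (A B : ℝ) (hA : 0 < A) (hAB : A ≤ B)
    (hframe : ∀ f : H, Summable (fun j => (v j) ^ 2 * ‖Λ j (gfP (W j) f)‖ ^ 2) ∧
      A * ‖f‖ ^ 2 ≤ ∑' j, (v j) ^ 2 * ‖Λ j (gfP (W j) f)‖ ^ 2 ∧
      ∑' j, (v j) ^ 2 * ‖Λ j (gfP (W j) f)‖ ^ 2 ≤ B * ‖f‖ ^ 2)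
    (S Sinv : H →L[ℂ] H)
    (hS : ∀ f : H,
      HasSum (fun j =>
        (v j) ^ 2 • gfP (W j) (ContinuousLinearMap.adjoint (Λ j) (Λ j (gfP (W j) f)))) (S f))
    (hS1 : ∀ f : H, S (Sinv f) = f) (hS2 : ∀ f : H, Sinv (S f) = f)
    -- the canonical dual system
    (Λd : ∀ j, H →L[ℂ] G j) (hΛd : ∀ j, Λd j = ((Λ j).comp (gfP (W j))).comp Sinv) :
    (∀ Sd : H →L[ℂ] H,
      (∀ f : H,
        HasSum (fun j =>
          (v j) ^ 2 • gfPc ((W j).map (Sinv : H →ₗ[ℂ] H))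
            (ContinuousLinearMap.adjoint (Λd j)
              (Λd j (gfPc ((W j).map (Sinv : H →ₗ[ℂ] H)) f)))) (Sd f)) → Sd = Sinv) ∧
    (∀ f : H,
      HasSum (fun j =>
        (v j) ^ 2 • gfP (W j)
          (ContinuousLinearMap.adjoint (Λ j)
            (Λd j (gfPc ((W j).map (Sinv : H →ₗ[ℂ] H)) f)))) f) ∧
    (∀ f : H,
      HasSum (fun j =>
        (v j) ^ 2 • gfPc ((W j).map (Sinv : H →ₗ[ℂ] H))
          (ContinuousLinearMap.adjoint (Λd j) (Λ j (gfP (W j) f)))) f) := by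
  have hSsymm : ∀ x y, inner ℂ (S x) y = inner ℂ x (S y) := by
    refine inner_left_of_hasSum (fun j x y => ?_) hS
    rw [← Complex.coe_smul, ← Complex.coe_smul, inner_smul_left, inner_smul_right,
      Complex.conj_ofReal, gfP_inner_left, ContinuousLinearMap.adjoint_inner_left,
      ← ContinuousLinearMap.adjoint_inner_right, gfP_inner_left]
  have hsymm : ∀ x y, inner ℂ (Sinv x) y = inner ℂ x (Sinv y) := fun x y => by
    rw [← hS1 y, ← hSsymm, hS1, hS2]
  have hproj : ∀ j x, Λd j (gfPc ((W j).map (Sinv : H →ₗ[ℂ] H)) x) = Λd j x := fun j x => by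
    simp only [hΛd, ContinuousLinearMap.comp_apply, gfP_comp_gfPc_map hsymm]
  have hadj : ∀ j y, gfPc ((W j).map (Sinv : H →ₗ[ℂ] H)) (ContinuousLinearMap.adjoint (Λd j) y) =
      Sinv (gfP (W j) (ContinuousLinearMap.adjoint (Λ j) y)) := fun j y => by
    refine ext_inner_right ℂ fun z => ?_
    rw [gfPc_inner_left, ContinuousLinearMap.adjoint_inner_left, hproj, hsymm, gfP_inner_left,
      ContinuousLinearMap.adjoint_inner_left, hΛd]
    rfl
  have hd : ∀ j x, Λd j x = Λ j (gfP (W j) (Sinv x)) := fun j x => by rw [hΛd]; rfl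
  have hdual : ∀ f, HasSum (fun j => (v j) ^ 2 • gfPc ((W j).map (Sinv : H →ₗ[ℂ] H))
      (ContinuousLinearMap.adjoint (Λd j) (Λ j (gfP (W j) f)))) f := fun f => by
    have h := (hS f).mapL Sinv
    simpa only [hadj, hS2, map_smul_of_tower] using h
  refine ⟨fun Sd hSd => ContinuousLinearMap.ext fun f => ?_, fun f => ?_, hdual⟩
  · have h := hSd f
    simp only [hproj, hd] at h
    exact h.unique (hdual (Sinv f))
  · simpa only [hproj, hd, hS1] using hS (Sinv f)
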